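/- Let u : ℝ × ℝ → ℝ be a C² solution of the Born–Infeld equation satisfying the regularity/decay and smallness hypotheses, and let λ(t) = C t/(log t)². Then lim_{t→+∞} ∫_ℝ sech⁴(x/λ(t)) ( (1 + (∂ₓu)²)/(1 + (∂ₓu)² - (∂ₜu)²)^{1/2} - 1 )(t,x) dx = 0. -/

import Mathlib

open MeasureTheory Real Filter

/-- Time derivative `∂ₜ u` of a scalar field `u : ℝ × ℝ → ℝ` (first variable is time). -/
noncomputable def ut (u : ℝ × ℝ → ℝ) (t x : ℝ) : ℝ := deriv (fun s => u (s, x)) t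

/-- Space derivative `∂ₓ u`. -/
noncomputable def ux (u : ℝ × ℝ → ℝ) (t x : ℝ) : ℝ := deriv (fun y => u (t, y)) x

/-- `∂ₜ² u`. -/
noncomputable def utt (u : ℝ × ℝ → ℝ) (t x : ℝ) : ℝ := deriv (fun s => ut u s x) t

/-- `∂ₓ² u`. -/
noncomputable def uxx (u : ℝ × ℝ → ℝ) (t x : ℝ) : ℝ := deriv (fun y => ux u t y) x

/-- Mixed derivative `∂²ₜₓ u`. -/
noncomputable def utx (u : ℝ × ℝ → ℝ) (t x : ℝ) : ℝ := deriv (fun s => ux u s x) t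

/-- The Born–Infeld equation in 1+1 dimensions:
`(1 - (∂ₜu)²) ∂ₓ²u + 2 ∂ₓu ∂ₜu ∂²ₜₓu - (1 + (∂ₓu)²) ∂ₜ²u = 0`. -/
def IsBISol (u : ℝ × ℝ → ℝ) : Prop :=
  ∀ t x : ℝ,
    (1 - (ut u t x) ^ 2) * uxx u t x
      + 2 * ux u t x * ut u t x * utx u t x
      - (1 + (ux u t x) ^ 2) * utt u t x = 0

/-- The scaling function `λ(t) = C t / (log t)²`. -/
noncomputable def lam (C t : ℝ) : ℝ := C * t / (Real.log t) ^ 2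

/-- Hyperbolic secant. -/
noncomputable def sech (x : ℝ) : ℝ := 1 / Real.cosh x

/-- `F (t, ·)` vanishes outside a compact set, locally uniformly in `t`. -/
def LocallySpatiallyCompact (F : ℝ × ℝ → ℝ) : Prop :=
  ∀ T : ℝ, ∃ R : ℝ, ∀ t x : ℝ, |t| ≤ T → R ≤ |x| → F (t, x) = 0

lemma LocallySpatiallyCompact.exists_slice {F : ℝ × ℝ → ℝ} (hF : LocallySpatiallyCompact F)
    (t : ℝ) : ∃ R : ℝ, ∀ x : ℝ, R ≤ |x| → F (t, x) = 0 :=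
  let ⟨R, hR⟩ := hF |t|
  ⟨R, fun x hx => hR t x le_rfl hx⟩

lemma integrable_of_vanishing {f : ℝ → ℝ} (hf : Continuous f)
    (h : ∃ R : ℝ, ∀ x : ℝ, R ≤ |x| → f x = 0) : Integrable f := by
  obtain ⟨R, hR⟩ := h
  refine hf.integrable_of_hasCompactSupport
    (HasCompactSupport.intro (isCompact_Icc (a := -R) (b := R)) fun x hx => hR x ?_)
  by_contra! h'
  exact hx ⟨(abs_lt.1 h').1.le, (abs_lt.1 h').2.le⟩

/-- Multiplying a continuous, spatially compact density by a continuous weight. -/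
lemma integrable_weight_mul {F : ℝ × ℝ → ℝ} (hF : Continuous F)
    (hs : LocallySpatiallyCompact F) (t : ℝ) {g : ℝ → ℝ} (hg : Continuous g) :
    Integrable fun x => g x * F (t, x) := by
  obtain ⟨R, hR⟩ := hs.exists_slice t
  exact integrable_of_vanishing (hg.mul (by fun_prop)) ⟨R, fun x hx => by simp [hR x hx]⟩

/-- Differentiation under the integral sign for locally uniformly compactly supported integrands. -/
lemma hasDerivAt_integral_of_locallySpatiallyCompact {G G' : ℝ × ℝ → ℝ} {a t : ℝ} (ht : a < t)
    (hG : ∀ s, a < s → Continuous fun x => G (s, x))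
    (hG' : ContinuousOn G' (Set.Ioi a ×ˢ Set.univ))
    (hd : ∀ s, a < s → ∀ x, HasDerivAt (fun s => G (s, x)) (G' (s, x)) s)
    (hs : LocallySpatiallyCompact G) (hs' : LocallySpatiallyCompact G') :
    HasDerivAt (fun s => ∫ x, G (s, x)) (∫ x, G' (t, x)) t := by
  set δ := (t - a) / 2 with hδ
  have hδ0 : 0 < δ := by rw [hδ]; linarith
  obtain ⟨R, hR⟩ := hs' (|t| + δ)
  have hK : IsCompact (Set.Icc (t - δ) (t + δ) ×ˢ Set.Icc (-R) R) :=
    isCompact_Icc.prod isCompact_Icc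
  have hlt : ∀ s ∈ Set.Icc (t - δ) (t + δ), a < s := fun s h => by
    have := h.1
    rw [hδ] at this
    linarith
  obtain ⟨B, hB⟩ := hK.exists_bound_of_continuousOn
    (hG'.mono fun z hz => ⟨hlt _ hz.1, Set.mem_univ _⟩)
  have hslice : Continuous fun x => G' (t, x) :=
    hG'.comp_continuous (by fun_prop) fun x => ⟨ht, Set.mem_univ _⟩
  have hnhds : Set.Icc (t - δ) (t + δ) ∈ nhds t := Icc_mem_nhds (by linarith) (by linarith)
  refine (hasDerivAt_integral_of_dominated_loc_of_deriv_le (μ := volume)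
    (F := fun s x => G (s, x)) (F' := fun s x => G' (s, x))
    (bound := (Set.Icc (-R) R).indicator fun _ => B) hnhds ?_ ?_ ?_ ?_ ?_ ?_).2
  · filter_upwards [hnhds] with s hs
    exact (hG s (hlt s hs)).aestronglyMeasurable
  · exact integrable_of_vanishing (hG t ht) (hs.exists_slice t)
  · exact hslice.aestronglyMeasurable
  · refine Eventually.of_forall fun x s hst => ?_
    by_cases hx : x ∈ Set.Icc (-R) R
    · rw [Set.indicator_of_mem hx]
      exact hB (s, x) ⟨hst, hx⟩
    · rw [Set.indicator_of_notMem hx, hR s x, norm_zero]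
      · have h1 : |s - t| ≤ δ := abs_sub_le_iff.2 ⟨by linarith [hst.2], by linarith [hst.1]⟩
        have h2 := abs_sub_abs_le_abs_sub s t
        linarith
      · by_contra! h'
        exact hx ⟨(abs_lt.1 h').1.le, (abs_lt.1 h').2.le⟩
  · exact (integrable_indicator_iff measurableSet_Icc).2
      (continuousOn_const.integrableOn_compact isCompact_Icc)
  · exact Eventually.of_forall fun x s hst => hd s (hlt s hst) x

lemma hasDerivAt_time {F : ℝ × ℝ → ℝ} {t x : ℝ} (hF : DifferentiableAt ℝ F (t, x)) :
    HasDerivAt (fun s => F (s, x)) (fderiv ℝ F (t, x) (1, 0)) t :=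
  hF.hasFDerivAt.comp_hasDerivAt t ((hasDerivAt_id t).prodMk (hasDerivAt_const t x))

lemma hasDerivAt_space {F : ℝ × ℝ → ℝ} {t x : ℝ} (hF : DifferentiableAt ℝ F (t, x)) :
    HasDerivAt (fun y => F (t, y)) (fderiv ℝ F (t, x) (0, 1)) x :=
  hF.hasFDerivAt.comp_hasDerivAt x ((hasDerivAt_const x t).prodMk (hasDerivAt_id x))

lemma continuous_fderiv_apply_const {F : ℝ × ℝ → ℝ} (hF : ContDiff ℝ 1 F) (v : ℝ × ℝ) :
    Continuous fun z => fderiv ℝ F z v :=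
  (hF.continuous_fderiv one_ne_zero).clm_apply continuous_const

lemma LocallySpatiallyCompact.fderiv_time {F : ℝ × ℝ → ℝ} (hs : LocallySpatiallyCompact F)
    (hF : Differentiable ℝ F) : LocallySpatiallyCompact fun z => fderiv ℝ F z (1, 0) := by
  intro T
  obtain ⟨R, hR⟩ := hs (T + 1)
  refine ⟨R, fun t x ht hx => (hasDerivAt_time (hF (t, x))).unique ?_⟩
  refine (hasDerivAt_const t (0 : ℝ)).congr_of_eventuallyEq ?_
  filter_upwards [Metric.ball_mem_nhds t one_pos] with s hs
  rw [Metric.mem_ball, Real.dist_eq] at hs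
  exact hR s x (by linarith [abs_sub_abs_le_abs_sub s t]) hx

lemma LocallySpatiallyCompact.weight_mul {F : ℝ × ℝ → ℝ} (hs : LocallySpatiallyCompact F)
    (g : ℝ × ℝ → ℝ) : LocallySpatiallyCompact fun z => g z * F z := fun T =>
  let ⟨R, hR⟩ := hs T
  ⟨R, fun t x ht hx => by simp [hR t x ht hx]⟩

lemma LocallySpatiallyCompact.add {F G : ℝ × ℝ → ℝ} (hF : LocallySpatiallyCompact F)
    (hG : LocallySpatiallyCompact G) : LocallySpatiallyCompact fun z => F z + G z := fun T =>
  let ⟨R, hR⟩ := hF T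
  let ⟨R', hR'⟩ := hG T
  ⟨max R R', fun t x ht hx => by
    simp [hR t x ht ((le_max_left _ _).trans hx), hR' t x ht ((le_max_right _ _).trans hx)]⟩

/-- Virial identity for a conservation law `∂ₜ ρ = ∂ₓ j` against the weight `φ (x / l t)`. -/
lemma hasDerivAt_virial {ρ j : ℝ × ℝ → ℝ} (hρ : ContDiff ℝ 1 ρ) (hj : ContDiff ℝ 1 j)
    (hsρ : LocallySpatiallyCompact ρ) (hsj : LocallySpatiallyCompact j)
    (hcons : ∀ z, fderiv ℝ ρ z (1, 0) = fderiv ℝ j z (0, 1))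
    {φ φ' : ℝ → ℝ} (hφ : ∀ y, HasDerivAt φ (φ' y) y) (hφ' : Continuous φ')
    {l l' : ℝ → ℝ} {a : ℝ} (hl0 : ∀ s, a < s → 0 < l s)
    (hl : ∀ s, a < s → HasDerivAt l (l' s) s) (hl' : ContinuousOn l' (Set.Ioi a))
    {t : ℝ} (ht : a < t) :
    HasDerivAt (fun s => ∫ x, φ (x / l s) * ρ (s, x))
      (-(1 / l t) * ∫ x, φ' (x / l t) * (l' t * (x / l t) * ρ (t, x) + j (t, x))) t := by
  have hφc : Continuous φ := continuous_iff_continuousAt.2 fun y => (hφ y).continuousAt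
  have hlc : ContinuousOn l (Set.Ioi a) := fun s hs => (hl s hs).continuousAt.continuousWithinAt
  have hρd : Differentiable ℝ ρ := hρ.differentiable one_ne_zero
  have hjd : Differentiable ℝ j := hj.differentiable one_ne_zero
  have hρc := hρ.continuous
  have hjc := hj.continuous
  have hρt := continuous_fderiv_apply_const hρ (1, 0)
  have hjx := continuous_fderiv_apply_const hj (0, 1)
  have hst := hsρ.fderiv_time hρd
  have key := hasDerivAt_integral_of_locallySpatiallyCompact ht
    (G := fun z => φ (z.2 / l z.1) * ρ z)
    (G' := fun z => (φ' (z.2 / l z.1) * (-(z.2 / l z.1) * (l' z.1 / l z.1))) * ρ z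
      + φ (z.2 / l z.1) * fderiv ℝ ρ z (1, 0))
    (fun s _ => (hφc.comp (continuous_id.div_const (l s))).mul (by fun_prop)) ?_ ?_
    (hsρ.weight_mul _)
    ((hsρ.weight_mul _).add (hst.weight_mul _))
  · refine key.congr_deriv ?_
    have hne : l t ≠ 0 := (hl0 t ht).ne'
    simp only [hcons]
    have hstx : LocallySpatiallyCompact fun z => fderiv ℝ j z (0, 1) := by
      simpa only [hcons] using hst
    have i1 : Integrable fun x => (φ' (x / l t) * (-(x / l t) * (l' t / l t))) * ρ (t, x) :=
      integrable_weight_mul hρc hsρ t (by fun_prop)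
    have i2 : Integrable fun x => φ (x / l t) * fderiv ℝ j (t, x) (0, 1) :=
      integrable_weight_mul hjx hstx t (g := fun x => φ (x / l t)) (by fun_prop)
    have i3 : Integrable fun x => (φ' (x / l t) * (1 / l t)) * j (t, x) :=
      integrable_weight_mul hjc hsj t (by fun_prop)
    have i4 : Integrable fun x => φ (x / l t) * j (t, x) :=
      integrable_weight_mul hjc hsj t (g := fun x => φ (x / l t)) (by fun_prop)
    have parts : ∫ x, φ (x / l t) * fderiv ℝ j (t, x) (0, 1)
        = -∫ x, (φ' (x / l t) * (1 / l t)) * j (t, x) :=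
      integral_mul_deriv_eq_deriv_mul_of_integrable
        (fun x _ => (hφ (x / l t)).comp x ((hasDerivAt_id x).div_const (l t)))
        (fun x _ => hasDerivAt_space (hjd (t, x))) i2 i3 i4
    rw [integral_add i1 i2, parts, ← sub_eq_add_neg, ← integral_sub i1 i3,
      ← integral_const_mul]
    congr 1
    ext x
    field_simp
    ring
  · have hfst : ContinuousOn (fun z : ℝ × ℝ => z.1) (Set.Ioi a ×ˢ Set.univ) := continuousOn_fst
    have hmaps : Set.MapsTo (fun z : ℝ × ℝ => z.1) (Set.Ioi a ×ˢ Set.univ) (Set.Ioi a) :=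
      fun z hz => hz.1
    have c1 := hlc.comp hfst hmaps
    have c2 := hl'.comp hfst hmaps
    have hne : ∀ z ∈ Set.Ioi a ×ˢ (Set.univ : Set ℝ), (l ∘ fun z : ℝ × ℝ => z.1) z ≠ 0 :=
      fun z hz => (hl0 _ hz.1).ne'
    have c3 := (continuousOn_snd (s := Set.Ioi a ×ˢ (Set.univ : Set ℝ))).div c1 hne
    exact (((hφ'.comp_continuousOn c3).mul (c3.neg.mul (c2.div c1 hne))).mul
      hρc.continuousOn).add ((hφc.comp_continuousOn c3).mul hρt.continuousOn)
  · intro s hs x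
    have hne : l s ≠ 0 := (hl0 s hs).ne'
    have h1 : HasDerivAt (fun s => x / l s) (-(x / l s) * (l' s / l s)) s :=
      ((hasDerivAt_const s x).div (hl s hs) hne).congr_deriv (by field_simp; ring)
    exact ((hφ (x / l s)).comp s h1).mul (hasDerivAt_time (hρd (s, x)))

lemma exists_tendsto_of_monotoneOn_Ici {F : ℝ → ℝ} {T B : ℝ} (hF : MonotoneOn F (Set.Ici T))
    (hB : ∀ t, T ≤ t → F t ≤ B) : ∃ L, Tendsto F atTop (nhds L) := by
  have hm : Monotone fun t => F (max t T) := fun s t hst =>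
    hF (Set.mem_Ici.2 (le_max_right _ _)) (Set.mem_Ici.2 (le_max_right _ _))
      (max_le_max_right _ hst)
  refine ⟨_, (tendsto_atTop_ciSup hm ⟨B, ?_⟩).congr' ?_⟩
  · rintro _ ⟨t, rfl⟩
    exact hB _ (le_max_right _ _)
  · filter_upwards [eventually_ge_atTop T] with t ht
    rw [max_eq_left ht]

lemma monotoneOn_Ici_of_hasDerivAt {F F' : ℝ → ℝ} {T : ℝ}
    (h : ∀ t, T ≤ t → HasDerivAt F (F' t) t) (h0 : ∀ t, T ≤ t → 0 ≤ F' t) :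
    MonotoneOn F (Set.Ici T) := by
  refine monotoneOn_of_deriv_nonneg (convex_Ici T)
    (fun t ht => (h t ht).continuousAt.continuousWithinAt)
    (fun t ht => ?_) fun t ht => ?_
  all_goals rw [interior_Ici] at ht
  · exact (h t (Set.mem_Ioi.1 ht).le).differentiableAt.differentiableWithinAt
  · rw [(h t (Set.mem_Ioi.1 ht).le).deriv]
    exact h0 t (Set.mem_Ioi.1 ht).le

/-- A bounded Lyapunov functional `M` whose growth controls both the variation of `K` and `K / t`
forces `K` to vanish at infinity. -/
lemma tendsto_zero_of_lyapunov {M M' K K' : ℝ → ℝ} {T B c : ℝ} (hT : 0 < T) (hc : 0 < c)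
    (hM : ∀ t, T ≤ t → HasDerivAt M (M' t) t) (hK : ∀ t, T ≤ t → HasDerivAt K (K' t) t)
    (hMB : ∀ t, T ≤ t → |M t| ≤ B) (hK0 : ∀ t, T ≤ t → 0 ≤ K t) (hKB : ∀ t, T ≤ t → K t ≤ B)
    (hK' : ∀ t, T ≤ t → |K' t| ≤ c * M' t) (hKM : ∀ t, T ≤ t → K t / t ≤ c * M' t) :
    Tendsto K atTop (nhds 0) := by
  have hM0 : ∀ t, T ≤ t → 0 ≤ M' t := fun t ht =>
    nonneg_of_mul_nonneg_right ((abs_nonneg _).trans (hK' t ht)) hc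
  obtain ⟨L, hL⟩ := exists_tendsto_of_monotoneOn_Ici (monotoneOn_Ici_of_hasDerivAt hM hM0)
    fun t ht => (abs_le.1 (hMB t ht)).2
  obtain ⟨L', hL'⟩ := exists_tendsto_of_monotoneOn_Ici (F := fun t => K t + c * M t)
    (B := B + c * B)
    (monotoneOn_Ici_of_hasDerivAt (fun t ht => (hK t ht).add ((hM t ht).const_mul c))
      fun t ht => by linarith [(abs_le.1 (hK' t ht)).1])
    fun t ht => by
      have := mul_le_mul_of_nonneg_left (abs_le.1 (hMB t ht)).2 hc.le
      linarith [hKB t ht]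
  have hlim : Tendsto K atTop (nhds (L' - c * L)) :=
    (hL'.sub (hL.const_mul c)).congr fun t => by ring
  set k := L' - c * L
  have hk0 : 0 ≤ k := ge_of_tendsto hlim (by
    filter_upwards [eventually_ge_atTop T] with t ht using hK0 t ht)
  rcases hk0.eq_or_lt with h | hk
  · rwa [← h] at hlim
  exfalso
  obtain ⟨T₁, hT₁⟩ := eventually_atTop.1 (hlim.eventually (lt_mem_nhds (half_lt_self hk)))
  set S := max T T₁
  have hTS : T ≤ S := le_max_left _ _
  have hmono : MonotoneOn (fun t => c * M t - k / 2 * log t) (Set.Ici S) :=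
    monotoneOn_Ici_of_hasDerivAt
      (fun t ht => ((hM t (hTS.trans ht)).const_mul c).sub
        ((hasDerivAt_log (hT.trans_le (hTS.trans ht)).ne').const_mul (k / 2)))
      fun t ht => by
        have ht0 : 0 < t := hT.trans_le (hTS.trans ht)
        have h1 := hKM t (hTS.trans ht)
        have h2 := div_le_div_of_nonneg_right (hT₁ t ((le_max_right _ _).trans ht)).le ht0.le
        rw [← div_eq_mul_inv]
        linarith
  have hlog : ∀ t, S ≤ t → log t ≤ (c * B - (c * M S - k / 2 * log S)) / (k / 2) := fun t ht => by
    have h1 := hmono (Set.mem_Ici.2 le_rfl) (Set.mem_Ici.2 ht) ht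
    have h2 := mul_le_mul_of_nonneg_left (abs_le.1 (hMB t (hTS.trans ht))).2 hc.le
    simp only at h1
    rw [le_div_iff₀ (half_pos hk)]
    linarith
  obtain ⟨t, ht, hts⟩ := ((tendsto_log_atTop.eventually_gt_atTop
    ((c * B - (c * M S - k / 2 * log S)) / (k / 2))).and (eventually_ge_atTop S)).exists
  exact absurd (hlog t hts) (not_le.2 ht)

/-- Momentum density (and energy flux) in terms of `p = ∂ₓ u`, `q = ∂ₜ u`. -/
noncomputable def momentumDensity (p q : ℝ) : ℝ := p * q / √(1 + p ^ 2 - q ^ 2)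

/-- Energy density in terms of `p = ∂ₓ u`, `q = ∂ₜ u`. -/
noncomputable def energyDensity (p q : ℝ) : ℝ := (1 + p ^ 2) / √(1 + p ^ 2 - q ^ 2) - 1

/-- Momentum flux in terms of `p = ∂ₓ u`, `q = ∂ₜ u`. -/
noncomputable def momentumFlux (p q : ℝ) : ℝ := 1 - (1 - q ^ 2) / √(1 + p ^ 2 - q ^ 2)

section Derivatives

variable {p q : ℝ → ℝ} {p' q' t : ℝ}

lemma hasDerivAt_lagrangian (hp : HasDerivAt p p' t) (hq : HasDerivAt q q' t)
    (h : 0 < 1 + p t ^ 2 - q t ^ 2) :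
    HasDerivAt (fun s => √(1 + p s ^ 2 - q s ^ 2))
      ((p t * p' - q t * q') / √(1 + p t ^ 2 - q t ^ 2)) t := by
  refine ((((hp.pow 2).const_add 1).sub (hq.pow 2)).sqrt h.ne').congr_deriv ?_
  have : √(1 + p t ^ 2 - q t ^ 2) ≠ 0 := (sqrt_pos.2 h).ne'
  simp only [Pi.sub_apply, Pi.pow_apply]
  field_simp
  ring

lemma hasDerivAt_momentumDensity (hp : HasDerivAt p p' t) (hq : HasDerivAt q q' t)
    (h : 0 < 1 + p t ^ 2 - q t ^ 2) :
    HasDerivAt (fun s => momentumDensity (p s) (q s))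
      (((p' * q t + p t * q') * (1 + p t ^ 2 - q t ^ 2) - p t * q t * (p t * p' - q t * q'))
        / √(1 + p t ^ 2 - q t ^ 2) ^ 3) t := by
  have h0 : √(1 + p t ^ 2 - q t ^ 2) ≠ 0 := (sqrt_pos.2 h).ne'
  refine ((hp.mul hq).div (hasDerivAt_lagrangian hp hq h) h0).congr_deriv ?_
  have hS := sq_sqrt h.le
  simp only [Pi.mul_apply]
  field_simp
  rw [hS]

lemma hasDerivAt_energyDensity (hp : HasDerivAt p p' t) (hq : HasDerivAt q q' t)
    (h : 0 < 1 + p t ^ 2 - q t ^ 2) :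
    HasDerivAt (fun s => energyDensity (p s) (q s))
      ((2 * p t * p' * (1 + p t ^ 2 - q t ^ 2) - (1 + p t ^ 2) * (p t * p' - q t * q'))
        / √(1 + p t ^ 2 - q t ^ 2) ^ 3) t := by
  have h0 : √(1 + p t ^ 2 - q t ^ 2) ≠ 0 := (sqrt_pos.2 h).ne'
  refine ((((hp.pow 2).const_add 1).div (hasDerivAt_lagrangian hp hq h) h0).sub_const 1).congr_deriv
    ?_
  have hS := sq_sqrt h.le
  simp only [Pi.pow_apply]
  field_simp
  rw [hS]
  ring

lemma hasDerivAt_momentumFlux (hp : HasDerivAt p p' t) (hq : HasDerivAt q q' t)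
    (h : 0 < 1 + p t ^ 2 - q t ^ 2) :
    HasDerivAt (fun s => momentumFlux (p s) (q s))
      ((2 * q t * q' * (1 + p t ^ 2 - q t ^ 2) + (1 - q t ^ 2) * (p t * p' - q t * q'))
        / √(1 + p t ^ 2 - q t ^ 2) ^ 3) t := by
  have h0 : √(1 + p t ^ 2 - q t ^ 2) ≠ 0 := (sqrt_pos.2 h).ne'
  refine ((((hq.pow 2).const_sub 1).div (hasDerivAt_lagrangian hp hq h) h0).const_sub 1).congr_deriv
    ?_
  have hS := sq_sqrt h.le
  simp only [Pi.pow_apply]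
  field_simp
  rw [hS]
  ring

end Derivatives

section Bounds

variable {p q : ℝ}

lemma lagrangian_bounds (h : |p| + |q| ≤ 1 / 2) :
    1 / 2 ≤ √(1 + p ^ 2 - q ^ 2) ∧ √(1 + p ^ 2 - q ^ 2) ≤ 3 / 2 ∧
      √(1 + p ^ 2 - q ^ 2) ^ 2 = 1 + p ^ 2 - q ^ 2 := by
  have hp : p ^ 2 ≤ (1 / 2) ^ 2 := sq_le_sq' (by linarith [neg_abs_le p, abs_nonneg q])
    (by linarith [le_abs_self p, abs_nonneg q])
  have hq : q ^ 2 ≤ (1 / 2) ^ 2 := sq_le_sq' (by linarith [neg_abs_le q, abs_nonneg p])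
    (by linarith [le_abs_self q, abs_nonneg p])
  refine ⟨le_sqrt_of_sq_le ?_, sqrt_le_iff.2 ⟨by norm_num, ?_⟩, sq_sqrt ?_⟩ <;>
    nlinarith [sq_nonneg p, sq_nonneg q]

lemma lagrangian_arg_pos (h : |p| + |q| ≤ 1 / 2) : 0 < 1 + p ^ 2 - q ^ 2 := by
  obtain ⟨h1, -, h2⟩ := lagrangian_bounds h
  rw [← h2]
  positivity

lemma abs_momentumDensity_le (h : |p| + |q| ≤ 1 / 2) :
    |momentumDensity p q| ≤ p ^ 2 + q ^ 2 := by
  obtain ⟨h1, -, -⟩ := lagrangian_bounds h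
  have h0 : 0 < √(1 + p ^ 2 - q ^ 2) := by linarith
  rw [momentumDensity, abs_div, abs_of_pos h0, div_le_iff₀ h0, abs_mul]
  nlinarith [sq_abs p, sq_abs q, sq_nonneg (|p| - |q|), sq_nonneg p, sq_nonneg q]

lemma energyDensity_nonneg (h : |p| + |q| ≤ 1 / 2) : 0 ≤ energyDensity p q := by
  obtain ⟨h1, h2, h3⟩ := lagrangian_bounds h
  have h0 : 0 < √(1 + p ^ 2 - q ^ 2) := by linarith
  rw [energyDensity, sub_nonneg, one_le_div h0]
  nlinarith [sq_nonneg (√(1 + p ^ 2 - q ^ 2) - 1), sq_nonneg p, sq_nonneg q]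

lemma energyDensity_le (h : |p| + |q| ≤ 1 / 2) : energyDensity p q ≤ 2 * (p ^ 2 + q ^ 2) := by
  obtain ⟨h1, h2, h3⟩ := lagrangian_bounds h
  set S := √(1 + p ^ 2 - q ^ 2) with hS
  have h0 : 0 < S := by linarith
  have : energyDensity p q = (q ^ 2 + p ^ 2 * S) / (S * (1 + S)) := by
    rw [energyDensity, ← hS]
    field_simp
    linear_combination (-1) * h3
  rw [this, div_le_iff₀ (by positivity)]
  nlinarith [mul_nonneg (sq_nonneg q) (sub_nonneg.2 h1), mul_nonneg (sq_nonneg p) (sub_nonneg.2 h1),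
    mul_nonneg (sq_nonneg q) (mul_nonneg h0.le (sub_nonneg.2 h1)),
    mul_nonneg (sq_nonneg p) (mul_nonneg h0.le (sub_nonneg.2 h1))]

lemma le_momentumFlux (h : |p| + |q| ≤ 1 / 2) : (p ^ 2 + q ^ 2) / 8 ≤ momentumFlux p q := by
  obtain ⟨h1, h2, h3⟩ := lagrangian_bounds h
  set S := √(1 + p ^ 2 - q ^ 2) with hS
  have h0 : 0 < S := by linarith
  have : momentumFlux p q = (p ^ 2 + q ^ 2 * S) / (S * (1 + S)) := by
    rw [momentumFlux, ← hS]
    field_simp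
    linear_combination h3
  have h4 : S * (1 + S) ≤ 15 / 4 := by nlinarith
  rw [this, le_div_iff₀ (by positivity)]
  nlinarith [mul_nonneg (sq_nonneg q) (sub_nonneg.2 h1), sq_nonneg p, sq_nonneg q,
    mul_le_mul_of_nonneg_left h4 (add_nonneg (sq_nonneg p) (sq_nonneg q))]

end Bounds

section Weights

lemma one_add_sq_le_cosh_sq (y : ℝ) : 1 + y ^ 2 ≤ cosh y ^ 2 := by
  have h : |y| ≤ |sinh y| := by
    rw [abs_sinh]
    exact self_le_sinh_iff.2 (abs_nonneg y)
  rw [cosh_sq]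
  linarith [sq_le_sq.2 h]

lemma hasDerivAt_sech_pow_four (y : ℝ) :
    HasDerivAt (fun y => sech y ^ 4) (-4 * sinh y / cosh y ^ 5) y := by
  have h0 := (cosh_pos y).ne'
  refine ((((hasDerivAt_const y (1 : ℝ)).div (hasDerivAt_cosh y) h0).pow 4).congr_deriv ?_)
  simp only [Pi.div_apply, one_div, inv_pow]
  field_simp
  push_cast
  ring

lemma sech_pow_four_le (y : ℝ) : sech y ^ 4 ≤ 1 / (1 + y ^ 2) := by
  have h := one_add_sq_le_cosh_sq y
  rw [sech, div_pow, one_pow]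
  refine one_div_le_one_div_of_le (by positivity) ?_
  nlinarith [one_le_cosh y]

/-- Both `(sech⁴)'` and `y (sech⁴)'` are controlled by `(1 + y²)⁻¹`. -/
lemma abs_sech_pow_four_deriv_mul_le (y : ℝ) :
    |-4 * sinh y / cosh y ^ 5| * (1 + |y|) ≤ 8 * (1 / (1 + y ^ 2)) := by
  have h := one_add_sq_le_cosh_sq y
  have hc := cosh_pos y
  have hs : |sinh y| ≤ cosh y := abs_le_of_sq_le_sq (by rw [cosh_sq]; linarith) hc.le
  have h1 : |-4 * sinh y / cosh y ^ 5| ≤ 4 / (1 + y ^ 2) ^ 2 := by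
    rw [abs_div, abs_mul, abs_of_pos (pow_pos hc 5),
      div_le_div_iff₀ (by positivity) (by positivity)]
    norm_num
    have h2 : (1 + y ^ 2) ^ 2 ≤ cosh y ^ 4 := by
      calc (1 + y ^ 2) ^ 2 ≤ (cosh y ^ 2) ^ 2 := by gcongr
        _ = cosh y ^ 4 := by ring
    calc 4 * |sinh y| * (1 + y ^ 2) ^ 2 ≤ 4 * cosh y * cosh y ^ 4 := by gcongr
      _ = 4 * cosh y ^ 5 := by ring
  have h3 : 1 + |y| ≤ 2 * (1 + y ^ 2) := by
    nlinarith [sq_abs y, sq_nonneg (|y| - 1)]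
  calc _ ≤ 4 / (1 + y ^ 2) ^ 2 * (2 * (1 + y ^ 2)) := by gcongr
    _ = _ := by field_simp; norm_num

end Weights

section Scaling

lemma hasDerivAt_lam {C t : ℝ} (ht : 1 < t) :
    HasDerivAt (lam C) (C * (log t - 2) / log t ^ 3) t := by
  have hl : log t ≠ 0 := (log_pos ht).ne'
  have h0 : t ≠ 0 := by positivity
  refine (((hasDerivAt_id t).const_mul C).div ((hasDerivAt_log h0).pow 2)
    (pow_ne_zero 2 hl)).congr_deriv ?_
  simp only [Pi.pow_apply, id]
  field_simp
  push_cast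
  ring

lemma lam_pos {C t : ℝ} (hC : 0 < C) (ht : 1 < t) : 0 < lam C t := by
  have := log_pos ht
  rw [lam]
  positivity

lemma lam_deriv_bounds {C t : ℝ} (hC : 0 < C) (ht : exp 2 ≤ t) :
    0 ≤ C * (log t - 2) / log t ^ 3 ∧ C * (log t - 2) / log t ^ 3 ≤ C / log t ^ 2 := by
  have hl : 2 ≤ log t := (le_log_iff_exp_le ((exp_pos 2).trans_le ht)).2 ht
  refine ⟨div_nonneg (mul_nonneg hC.le (by linarith)) (by positivity), ?_⟩
  rw [div_le_div_iff₀ (by positivity) (by positivity)]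
  have : 0 ≤ C * log t ^ 2 := by positivity
  nlinarith

end Scaling

/-- The first-order form of the Born–Infeld equation for `P = ∂ₓ u`, `Q = ∂ₜ u`, with small,
spatially compact data. -/
structure IsSmallBISystem (P Q : ℝ × ℝ → ℝ) : Prop where
  contDiff_P : ContDiff ℝ 1 P
  contDiff_Q : ContDiff ℝ 1 Q
  compact_P : LocallySpatiallyCompact P
  compact_Q : LocallySpatiallyCompact Q
  symm : ∀ z, fderiv ℝ P z (1, 0) = fderiv ℝ Q z (0, 1)
  eqn : ∀ z, (1 - Q z ^ 2) * fderiv ℝ P z (0, 1) + 2 * P z * Q z * fderiv ℝ P z (1, 0)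
    - (1 + P z ^ 2) * fderiv ℝ Q z (1, 0) = 0
  small : ∀ z, |P z| + |Q z| ≤ 1 / 2

namespace IsSmallBISystem

variable {P Q : ℝ × ℝ → ℝ}

lemma contDiff_lagrangian (h : IsSmallBISystem P Q) :
    ContDiff ℝ 1 fun z => √(1 + P z ^ 2 - Q z ^ 2) :=
  ((contDiff_const.add (h.contDiff_P.pow 2)).sub (h.contDiff_Q.pow 2)).sqrt
    fun z => (lagrangian_arg_pos (h.small z)).ne'

lemma lagrangian_ne_zero (h : IsSmallBISystem P Q) (z : ℝ × ℝ) : √(1 + P z ^ 2 - Q z ^ 2) ≠ 0 :=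
  (sqrt_pos.2 (lagrangian_arg_pos (h.small z))).ne'

lemma contDiff_momentum (h : IsSmallBISystem P Q) :
    ContDiff ℝ 1 fun z => momentumDensity (P z) (Q z) :=
  (h.contDiff_P.mul h.contDiff_Q).div h.contDiff_lagrangian h.lagrangian_ne_zero

lemma contDiff_energy (h : IsSmallBISystem P Q) : ContDiff ℝ 1 fun z => energyDensity (P z) (Q z) :=
  ((contDiff_const.add (h.contDiff_P.pow 2)).div h.contDiff_lagrangian
    h.lagrangian_ne_zero).sub contDiff_const

lemma contDiff_flux (h : IsSmallBISystem P Q) : ContDiff ℝ 1 fun z => momentumFlux (P z) (Q z) :=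
  contDiff_const.sub ((contDiff_const.sub (h.contDiff_Q.pow 2)).div h.contDiff_lagrangian
    h.lagrangian_ne_zero)

lemma compact_comp (h : IsSmallBISystem P Q) {f : ℝ → ℝ → ℝ} (hf : f 0 0 = 0) :
    LocallySpatiallyCompact fun z => f (P z) (Q z) := fun T =>
  let ⟨R, hR⟩ := h.compact_P T
  let ⟨R', hR'⟩ := h.compact_Q T
  ⟨max R R', fun t x ht hx => by
    simp [hR t x ht ((le_max_left _ _).trans hx), hR' t x ht ((le_max_right _ _).trans hx), hf]⟩

lemma compact_momentum (h : IsSmallBISystem P Q) :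
    LocallySpatiallyCompact fun z => momentumDensity (P z) (Q z) :=
  h.compact_comp (by simp [momentumDensity])

lemma compact_energy (h : IsSmallBISystem P Q) :
    LocallySpatiallyCompact fun z => energyDensity (P z) (Q z) :=
  h.compact_comp (by simp [energyDensity])

lemma compact_flux (h : IsSmallBISystem P Q) :
    LocallySpatiallyCompact fun z => momentumFlux (P z) (Q z) :=
  h.compact_comp (by simp [momentumFlux])

lemma compact_sq (h : IsSmallBISystem P Q) : LocallySpatiallyCompact fun z => P z ^ 2 + Q z ^ 2 :=
  h.compact_comp (f := fun p q => p ^ 2 + q ^ 2) (by simp)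

lemma continuous_sq (h : IsSmallBISystem P Q) : Continuous fun z => P z ^ 2 + Q z ^ 2 :=
  (h.contDiff_P.continuous.pow 2).add (h.contDiff_Q.continuous.pow 2)

lemma energy_conservation (h : IsSmallBISystem P Q) (z : ℝ × ℝ) :
    fderiv ℝ (fun z => energyDensity (P z) (Q z)) z (1, 0)
      = fderiv ℝ (fun z => momentumDensity (P z) (Q z)) z (0, 1) := by
  obtain ⟨t, x⟩ := z
  have hP := h.contDiff_P.differentiable one_ne_zero (t, x)
  have hQ := h.contDiff_Q.differentiable one_ne_zero (t, x)
  have hpos := lagrangian_arg_pos (h.small (t, x))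
  rw [(hasDerivAt_time (h.contDiff_energy.differentiable one_ne_zero (t, x))).unique
      (hasDerivAt_energyDensity (hasDerivAt_time hP) (hasDerivAt_time hQ) hpos),
    (hasDerivAt_space (h.contDiff_momentum.differentiable one_ne_zero (t, x))).unique
      (hasDerivAt_momentumDensity (hasDerivAt_space hP) (hasDerivAt_space hQ) hpos)]
  congr 1
  rw [← h.symm]
  linear_combination (-Q (t, x)) * h.eqn (t, x)

lemma momentum_conservation (h : IsSmallBISystem P Q) (z : ℝ × ℝ) :
    fderiv ℝ (fun z => momentumDensity (P z) (Q z)) z (1, 0)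
      = fderiv ℝ (fun z => momentumFlux (P z) (Q z)) z (0, 1) := by
  obtain ⟨t, x⟩ := z
  have hP := h.contDiff_P.differentiable one_ne_zero (t, x)
  have hQ := h.contDiff_Q.differentiable one_ne_zero (t, x)
  have hpos := lagrangian_arg_pos (h.small (t, x))
  rw [(hasDerivAt_time (h.contDiff_momentum.differentiable one_ne_zero (t, x))).unique
      (hasDerivAt_momentumDensity (hasDerivAt_time hP) (hasDerivAt_time hQ) hpos),
    (hasDerivAt_space (h.contDiff_flux.differentiable one_ne_zero (t, x))).unique
      (hasDerivAt_momentumFlux (hasDerivAt_space hP) (hasDerivAt_space hQ) hpos)]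
  congr 1
  rw [← h.symm]
  linear_combination (-P (t, x)) * h.eqn (t, x)

section Estimates

variable {l l' E t : ℝ}

lemma integrable_sq (h : IsSmallBISystem P Q) (t : ℝ) :
    Integrable fun x => P (t, x) ^ 2 + Q (t, x) ^ 2 := by
  simpa using integrable_weight_mul h.continuous_sq h.compact_sq t (g := fun _ => 1)
    continuous_const

lemma integrable_weighted_sq (h : IsSmallBISystem P Q) (t l : ℝ) :
    Integrable fun x => 1 / (1 + (x / l) ^ 2) * (P (t, x) ^ 2 + Q (t, x) ^ 2) :=
  integrable_weight_mul h.continuous_sq h.compact_sq t (g := fun x => 1 / (1 + (x / l) ^ 2))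
    (by fun_prop (disch := intro x; positivity))

lemma abs_virial_le (h : IsSmallBISystem P Q)
    (hE : ∫ x, (P (t, x) ^ 2 + Q (t, x) ^ 2) ≤ E) :
    |∫ x, arctan (x / l) * momentumDensity (P (t, x)) (Q (t, x))| ≤ 2 * E := by
  refine (norm_integral_le_of_norm_le (G := ℝ) ((h.integrable_sq t).const_mul 2)
    (Eventually.of_forall fun x => ?_)).trans ?_
  · rw [norm_mul, Real.norm_eq_abs, Real.norm_eq_abs]
    have : |arctan (x / l)| ≤ 2 := abs_le.2
      ⟨by linarith [neg_pi_div_two_lt_arctan (x / l), pi_lt_four],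
        by linarith [arctan_lt_pi_div_two (x / l), pi_lt_four]⟩
    gcongr
    exact abs_momentumDensity_le (h.small (t, x))
  · rw [integral_const_mul]
    linarith

/-- Coercivity of the time derivative of the virial functional. -/
lemma le_virial_deriv (h : IsSmallBISystem P Q)
    (hE : ∫ x, (P (t, x) ^ 2 + Q (t, x) ^ 2) ≤ E) :
    (∫ x, 1 / (1 + (x / l) ^ 2) * (P (t, x) ^ 2 + Q (t, x) ^ 2)) / 16 - 4 * l' ^ 2 * E
      ≤ ∫ x, 1 / (1 + (x / l) ^ 2) * (l' * (x / l) * momentumDensity (P (t, x)) (Q (t, x))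
        + momentumFlux (P (t, x)) (Q (t, x))) := by
  have hw : Continuous fun x : ℝ => 1 / (1 + (x / l) ^ 2) := by
    fun_prop (disch := intro x; positivity)
  have i1 : Integrable fun x => 1 / (1 + (x / l) ^ 2) * (l' * (x / l) *
      momentumDensity (P (t, x)) (Q (t, x)) + momentumFlux (P (t, x)) (Q (t, x))) := by
    refine ((integrable_weight_mul h.contDiff_momentum.continuous h.compact_momentum t
      (hw.mul (by fun_prop : Continuous fun x : ℝ => l' * (x / l)))).add
      (integrable_weight_mul h.contDiff_flux.continuous h.compact_flux t hw)).congr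
      (Eventually.of_forall fun x => ?_)
    simp only [Pi.add_apply, Pi.mul_apply]
    ring
  have i2 := (h.integrable_weighted_sq t l).div_const 16
  have i3 := (h.integrable_sq t).const_mul (4 * l' ^ 2)
  calc _ ≤ (∫ x, 1 / (1 + (x / l) ^ 2) * (P (t, x) ^ 2 + Q (t, x) ^ 2)) / 16
        - 4 * l' ^ 2 * ∫ x, (P (t, x) ^ 2 + Q (t, x) ^ 2) := by gcongr
    _ = ∫ x, (1 / (1 + (x / l) ^ 2) * (P (t, x) ^ 2 + Q (t, x) ^ 2) / 16
        - 4 * l' ^ 2 * (P (t, x) ^ 2 + Q (t, x) ^ 2)) := by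
      rw [integral_sub i2 i3, integral_div, integral_const_mul]
    _ ≤ _ := integral_mono (i2.sub i3) i1 fun x => by
      have hm := abs_momentumDensity_le (h.small (t, x))
      have hf := le_momentumFlux (h.small (t, x))
      set y := x / l
      set r := P (t, x) ^ 2 + Q (t, x) ^ 2 with hr
      set m := momentumDensity (P (t, x)) (Q (t, x))
      have hr0 : 0 ≤ r := by positivity
      have hw0 : 0 < 1 + y ^ 2 := by positivity
      have h1 : |l' * y * m| ≤ (1 / 16 + 4 * (l' * y) ^ 2) * r := by
        rw [abs_mul]
        have : |l' * y| ≤ 1 / 16 + 4 * (l' * y) ^ 2 := by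
          nlinarith [sq_abs (l' * y), sq_nonneg (|l' * y| - 1 / 8)]
        gcongr
      have h2 := (abs_le.1 h1).1
      have h3 : r / 16 - 4 * (l' * y) ^ 2 * r ≤
          l' * y * m + momentumFlux (P (t, x)) (Q (t, x)) := by
        linarith
      have h4 : 1 / (1 + y ^ 2) * (4 * (l' * y) ^ 2 * r) ≤ 4 * l' ^ 2 * r := by
        rw [div_mul_eq_mul_div, div_le_iff₀ hw0]
        have : 0 ≤ 4 * l' ^ 2 * r := by positivity
        linarith
      have h5 := mul_le_mul_of_nonneg_left h3 (one_div_pos.2 hw0).le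
      rw [mul_sub] at h5
      linarith

lemma integrable_localized_energy (h : IsSmallBISystem P Q) (t l : ℝ) :
    Integrable fun x => sech (x / l) ^ 4 * energyDensity (P (t, x)) (Q (t, x)) := by
  refine integrable_weight_mul h.contDiff_energy.continuous h.compact_energy t
    (g := fun x => sech (x / l) ^ 4) ?_
  have : Continuous fun y => sech y ^ 4 :=
    continuous_iff_continuousAt.2 fun y => (hasDerivAt_sech_pow_four y).continuousAt
  exact this.comp (continuous_id.div_const l)

lemma localized_energy_nonneg (h : IsSmallBISystem P Q) :
    0 ≤ ∫ x, sech (x / l) ^ 4 * energyDensity (P (t, x)) (Q (t, x)) :=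
  integral_nonneg fun x => mul_nonneg (by positivity) (energyDensity_nonneg (h.small (t, x)))

lemma localized_energy_le_weighted (h : IsSmallBISystem P Q) :
    ∫ x, sech (x / l) ^ 4 * energyDensity (P (t, x)) (Q (t, x))
      ≤ 2 * ∫ x, 1 / (1 + (x / l) ^ 2) * (P (t, x) ^ 2 + Q (t, x) ^ 2) := by
  rw [← integral_const_mul]
  refine integral_mono (h.integrable_localized_energy t l)
    ((h.integrable_weighted_sq t l).const_mul 2) fun x => ?_
  have := mul_le_mul (sech_pow_four_le (x / l)) (energyDensity_le (h.small (t, x)))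
    (energyDensity_nonneg (h.small (t, x))) (by positivity)
  simp only
  linarith

lemma weighted_sq_le (h : IsSmallBISystem P Q)
    (hE : ∫ x, (P (t, x) ^ 2 + Q (t, x) ^ 2) ≤ E) :
    ∫ x, 1 / (1 + (x / l) ^ 2) * (P (t, x) ^ 2 + Q (t, x) ^ 2) ≤ E := by
  refine (integral_mono (h.integrable_weighted_sq t l) (h.integrable_sq t) fun x => ?_).trans hE
  refine mul_le_of_le_one_left (by positivity) ?_
  rw [div_le_one (by positivity)]
  nlinarith [sq_nonneg (x / l)]

lemma abs_localized_energy_deriv_le (h : IsSmallBISystem P Q)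
    {k : ℝ} (hl'0 : 0 ≤ l') (hl'k : l' ≤ k) :
    |∫ x, -4 * sinh (x / l) / cosh (x / l) ^ 5 * (l' * (x / l) * energyDensity (P (t, x)) (Q (t, x))
        + momentumDensity (P (t, x)) (Q (t, x)))|
      ≤ 8 * (2 * k + 1) * ∫ x, 1 / (1 + (x / l) ^ 2) * (P (t, x) ^ 2 + Q (t, x) ^ 2) := by
  rw [← integral_const_mul]
  refine norm_integral_le_of_norm_le (G := ℝ)
    ((h.integrable_weighted_sq t l).const_mul (8 * (2 * k + 1)))
    (Eventually.of_forall fun x => ?_)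
  have hm := abs_momentumDensity_le (h.small (t, x))
  have he := energyDensity_le (h.small (t, x))
  have he0 := energyDensity_nonneg (h.small (t, x))
  have hg := abs_sech_pow_four_deriv_mul_le (x / l)
  set y := x / l
  set r := P (t, x) ^ 2 + Q (t, x) ^ 2
  have hr0 : 0 ≤ r := by positivity
  have hk : 0 ≤ k := hl'0.trans hl'k
  rw [norm_mul, Real.norm_eq_abs, Real.norm_eq_abs]
  have h1 : |l' * y * energyDensity (P (t, x)) (Q (t, x)) + momentumDensity (P (t, x)) (Q (t, x))|
      ≤ (1 + |y|) * ((2 * k + 1) * r) := by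
    calc _ ≤ |l' * y * energyDensity (P (t, x)) (Q (t, x))|
          + |momentumDensity (P (t, x)) (Q (t, x))| := abs_add_le _ _
      _ ≤ k * |y| * (2 * r) + r := by
        rw [abs_mul, abs_mul, abs_of_nonneg hl'0, abs_of_nonneg he0]
        gcongr
      _ ≤ _ := by nlinarith [mul_nonneg (abs_nonneg y) hr0, mul_nonneg hk hr0]
  calc _ ≤ |-4 * sinh y / cosh y ^ 5| * ((1 + |y|) * ((2 * k + 1) * r)) := by gcongr
    _ = |-4 * sinh y / cosh y ^ 5| * (1 + |y|) * ((2 * k + 1) * r) := by ring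
    _ ≤ 8 * (1 / (1 + y ^ 2)) * ((2 * k + 1) * r) := by gcongr
    _ = _ := by ring

end Estimates

theorem tendsto_localized_energy (h : IsSmallBISystem P Q) {C E : ℝ} (hC : 0 < C)
    (hE : ∀ t, ∫ x, (P (t, x) ^ 2 + Q (t, x) ^ 2) ≤ E) :
    Tendsto (fun t => ∫ x, sech (x / lam C t) ^ 4 * energyDensity (P (t, x)) (Q (t, x)))
      atTop (nhds 0) := by
  set lam' : ℝ → ℝ := fun t => C * (log t - 2) / log t ^ 3 with hlam'
  set J : ℝ → ℝ := fun t => ∫ x, 1 / (1 + (x / lam C t) ^ 2) * (P (t, x) ^ 2 + Q (t, x) ^ 2)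
  have hE0 : 0 ≤ E := le_trans (integral_nonneg fun x => by positivity) (hE 0)
  have hlam'c : ContinuousOn lam' (Set.Ioi 1) := by
    have hlog : ContinuousOn log (Set.Ioi 1) := continuousOn_log.mono fun x hx =>
      (zero_lt_one.trans (Set.mem_Ioi.1 hx)).ne'
    exact (continuousOn_const.mul (hlog.sub continuousOn_const)).div (hlog.pow 3)
      fun x hx => pow_ne_zero 3 (log_pos (Set.mem_Ioi.1 hx)).ne'
  have hT1 : ∀ t, exp 2 ≤ t → 1 < t := fun t ht => (one_lt_exp_iff.2 two_pos).trans_le ht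
  have hlog2 : ∀ t, exp 2 ≤ t → 2 ≤ log t := fun t ht =>
    (le_log_iff_exp_le ((exp_pos 2).trans_le ht)).2 ht
  have hI : ∀ t, exp 2 ≤ t → HasDerivAt
      (fun s => ∫ x, arctan (x / lam C s) * momentumDensity (P (s, x)) (Q (s, x)))
      (-(1 / lam C t) * ∫ x, 1 / (1 + (x / lam C t) ^ 2) * (lam' t * (x / lam C t)
        * momentumDensity (P (t, x)) (Q (t, x)) + momentumFlux (P (t, x)) (Q (t, x)))) t :=
    fun t ht => hasDerivAt_virial (φ' := fun y => 1 / (1 + y ^ 2)) h.contDiff_momentum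
      h.contDiff_flux h.compact_momentum h.compact_flux h.momentum_conservation hasDerivAt_arctan
      (by fun_prop (disch := intro x; positivity)) (fun s hs => lam_pos hC hs)
      (fun s hs => hasDerivAt_lam hs) hlam'c (hT1 t ht)
  have hK : ∀ t, exp 2 ≤ t → HasDerivAt
      (fun s => ∫ x, sech (x / lam C s) ^ 4 * energyDensity (P (s, x)) (Q (s, x)))
      (-(1 / lam C t) * ∫ x, -4 * sinh (x / lam C t) / cosh (x / lam C t) ^ 5 * (lam' t *
        (x / lam C t) * energyDensity (P (t, x)) (Q (t, x))
        + momentumDensity (P (t, x)) (Q (t, x)))) t :=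
    fun t ht => hasDerivAt_virial (φ := fun y => sech y ^ 4)
      (φ' := fun y => -4 * sinh y / cosh y ^ 5) h.contDiff_energy
      h.contDiff_momentum h.compact_energy h.compact_momentum h.energy_conservation
      hasDerivAt_sech_pow_four
      (by fun_prop (disch := exact fun x => pow_ne_zero 5 (cosh_pos x).ne'))
      (fun s hs => lam_pos hC hs) (fun s hs => hasDerivAt_lam hs) hlam'c (hT1 t ht)
  have hM : ∀ t, exp 2 ≤ t → HasDerivAt (fun s =>
      -(∫ x, arctan (x / lam C s) * momentumDensity (P (s, x)) (Q (s, x))) - 4 * C * E * (log s)⁻¹)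
      (1 / lam C t * (∫ x, 1 / (1 + (x / lam C t) ^ 2) * (lam' t * (x / lam C t)
        * momentumDensity (P (t, x)) (Q (t, x)) + momentumFlux (P (t, x)) (Q (t, x))))
        + 4 * C * E * (1 / (t * log t ^ 2))) t := fun t ht => by
    have hl := hlog2 t ht
    have ht0 := hT1 t ht
    refine ((hI t ht).neg.sub (((hasDerivAt_log (by positivity)).inv
      (by positivity)).const_mul (4 * C * E))).congr_deriv ?_
    ring
  -- Lower bound for the growth of the Lyapunov functional.
  have hJ : ∀ t, exp 2 ≤ t → J t / lam C t ≤ 16 * (1 / lam C t * (∫ x, 1 / (1 + (x / lam C t) ^ 2) *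
      (lam' t * (x / lam C t) * momentumDensity (P (t, x)) (Q (t, x))
        + momentumFlux (P (t, x)) (Q (t, x)))) + 4 * C * E * (1 / (t * log t ^ 2))) :=
      fun t ht => by
    have hl := hlog2 t ht
    have ht0 : 0 < t := (exp_pos 2).trans_le ht
    have hlp := lam_pos hC (hT1 t ht)
    obtain ⟨h1, h2⟩ := lam_deriv_bounds hC ht
    have hv := mul_le_mul_of_nonneg_left (h.le_virial_deriv (l := lam C t) (l' := lam' t) (hE t))
      (one_div_pos.2 hlp).le
    have h3 : 1 / lam C t * (4 * lam' t ^ 2 * E) ≤ 4 * C * E * (1 / (t * log t ^ 2)) := by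
      calc 1 / lam C t * (4 * lam' t ^ 2 * E)
          ≤ 1 / lam C t * (4 * (C / log t ^ 2) ^ 2 * E) := by gcongr
        _ = _ := by
          rw [lam]
          field_simp
    rw [mul_sub] at hv
    have h4 : J t / lam C t = 16 * (1 / lam C t * (J t / 16)) := by ring
    rw [h4]
    linarith
  have hJ0 : ∀ t, 0 ≤ J t := fun t => integral_nonneg fun x => by positivity
  set c : ℝ := 16 * (8 * (2 * C + 1) + 2 * C) with hc
  refine tendsto_zero_of_lyapunov (c := c) (B := 2 * E + 4 * C * E) (exp_pos 2) (by positivity)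
    hM hK (fun t ht => ?_) (fun t _ => h.localized_energy_nonneg) (fun t _ => ?_)
    (fun t ht => ?_) fun t ht => ?_
  · have hl := hlog2 t ht
    refine (abs_sub _ _).trans (add_le_add ?_ ?_)
    · rw [abs_neg]
      exact h.abs_virial_le (hE t)
    · rw [abs_of_nonneg (by positivity)]
      exact mul_le_of_le_one_right (by positivity) (inv_le_one_of_one_le₀ (by linarith))
  · have h1 := h.localized_energy_le_weighted (t := t) (l := lam C t)
    have h2 := h.weighted_sq_le (l := lam C t) (hE t)
    have h3 : 0 ≤ 4 * C * E := by positivity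
    linarith
  · have hl := hlog2 t ht
    have hlp := lam_pos hC (hT1 t ht)
    obtain ⟨h1, h2⟩ := lam_deriv_bounds hC ht
    have h3 : lam' t ≤ C := h2.trans (div_le_self hC.le (by nlinarith))
    have h4 := h.abs_localized_energy_deriv_le (t := t) (l := lam C t) h1 h3
    have h5 : 0 ≤ J t / lam C t := div_nonneg (hJ0 t) hlp.le
    rw [abs_mul, abs_neg, abs_of_pos (one_div_pos.2 hlp)]
    calc _ ≤ 1 / lam C t * (8 * (2 * C + 1) * J t) := by gcongr
      _ = 8 * (2 * C + 1) * (J t / lam C t) := by ring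
      _ ≤ (8 * (2 * C + 1) + 2 * C) * (J t / lam C t) := by
        gcongr
        linarith
      _ ≤ (8 * (2 * C + 1) + 2 * C) * _ := mul_le_mul_of_nonneg_left (hJ t ht) (by positivity)
      _ = _ := by rw [hc]; ring
  · have hl := hlog2 t ht
    have ht0 : 0 < t := (exp_pos 2).trans_le ht
    have hlp := lam_pos hC (hT1 t ht)
    have h1 := h.localized_energy_le_weighted (t := t) (l := lam C t)
    have h5 : 0 ≤ J t / lam C t := div_nonneg (hJ0 t) hlp.le
    have h6 : 1 / t ≤ C / lam C t := by
      rw [div_le_div_iff₀ ht0 hlp, lam, one_mul]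
      exact div_le_self (by positivity) (by nlinarith)
    calc _ ≤ 2 * J t / t := by gcongr
      _ = 2 * J t * (1 / t) := by ring
      _ ≤ 2 * J t * (C / lam C t) := mul_le_mul_of_nonneg_left h6 (by linarith [hJ0 t])
      _ = 2 * C * (J t / lam C t) := by ring
      _ ≤ (8 * (2 * C + 1) + 2 * C) * (J t / lam C t) := by
        gcongr
        linarith
      _ ≤ (8 * (2 * C + 1) + 2 * C) * _ := mul_le_mul_of_nonneg_left (hJ t ht) (by positivity)
      _ = _ := by rw [hc]; ring

end IsSmallBISystem

/-- Decay of the localized energy: for any `C > 0` and `ε` sufficiently small,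
`∫ sech⁴(x/λ(t)) ((1+(∂ₓu)²)/√(1+(∂ₓu)²-(∂ₜu)²) - 1) dx → 0` as `t → +∞`. -/
theorem localized_energy_decay :
    ∃ ε₀ : ℝ, 0 < ε₀ ∧ ∀ C : ℝ, 0 < C → ∀ ε : ℝ, 0 < ε → ε ≤ ε₀ →
    ∀ u : ℝ × ℝ → ℝ, ContDiff ℝ 2 u → IsBISol u →
    (∀ t x : ℝ, |ux u t x| + |ut u t x| ≤ ε) →
    (∀ t : ℝ, ∫ x : ℝ, ((ux u t x) ^ 2 + (ut u t x) ^ 2) ≤ ε ^ 2) →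
    (∀ T : ℝ, ∃ R : ℝ, ∀ t x : ℝ, |t| ≤ T → R ≤ |x| → ux u t x = 0 ∧ ut u t x = 0) →
    Tendsto (fun t : ℝ => ∫ x : ℝ, (sech (x / lam C t)) ^ 4
        * ((1 + (ux u t x) ^ 2) / Real.sqrt (1 + (ux u t x) ^ 2 - (ut u t x) ^ 2) - 1))
      atTop (nhds 0) := by
  refine ⟨1 / 2, by norm_num, fun C hC ε _ hε' u hu hBI hsmall hE hcomp => ?_⟩
  have hud : Differentiable ℝ u := hu.differentiable two_ne_zero
  have hux : ∀ t x, ux u t x = fderiv ℝ u (t, x) (0, 1) := fun t x =>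
    (hasDerivAt_space (hud (t, x))).deriv
  have hut : ∀ t x, ut u t x = fderiv ℝ u (t, x) (1, 0) := fun t x =>
    (hasDerivAt_time (hud (t, x))).deriv
  have hdu : ContDiff ℝ 1 (fderiv ℝ u) := hu.fderiv_right (by norm_num)
  have hcd : ∀ v, ContDiff ℝ 1 fun z => fderiv ℝ u z v := fun v => hdu.clm_apply contDiff_const
  have hd : ∀ v z, DifferentiableAt ℝ (fun z => fderiv ℝ u z v) z := fun v =>
    (hcd v).differentiable one_ne_zero
  have hfd : ∀ v w z, fderiv ℝ (fun z => fderiv ℝ u z v) z w = fderiv ℝ (fderiv ℝ u) z w v :=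
    fun v w z => by
      rw [fderiv_clm_apply (hdu.differentiable one_ne_zero z) (differentiableAt_const v)]
      simp
  have hutt : ∀ t x, utt u t x = fderiv ℝ (fun z => fderiv ℝ u z (1, 0)) (t, x) (1, 0) :=
    fun t x => by
      simp only [utt, hut]
      exact (hasDerivAt_time (hd _ (t, x))).deriv
  have huxx : ∀ t x, uxx u t x = fderiv ℝ (fun z => fderiv ℝ u z (0, 1)) (t, x) (0, 1) :=
    fun t x => by
      simp only [uxx, hux]
      exact (hasDerivAt_space (hd _ (t, x))).deriv
  have hutx : ∀ t x, utx u t x = fderiv ℝ (fun z => fderiv ℝ u z (0, 1)) (t, x) (1, 0) :=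
    fun t x => by
      simp only [utx, hux]
      exact (hasDerivAt_time (hd _ (t, x))).deriv
  simp only [IsBISol, hutt, huxx, hutx, hux, hut] at hBI hsmall hE hcomp ⊢
  have hsys : IsSmallBISystem (fun z => fderiv ℝ u z (0, 1)) (fun z => fderiv ℝ u z (1, 0)) :=
    { contDiff_P := hcd _
      contDiff_Q := hcd _
      compact_P := fun T => (hcomp T).imp fun R hR t x ht hx => (hR t x ht hx).1
      compact_Q := fun T => (hcomp T).imp fun R hR t x ht hx => (hR t x ht hx).2
      symm := fun z => by
        rw [hfd, hfd]
        exact (hu.contDiffAt.isSymmSndFDerivAt (by simp)).eq _ _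
      eqn := fun z => hBI z.1 z.2
      small := fun z => (hsmall z.1 z.2).trans hε' }
  exact hsys.tendsto_localized_energy hC hE
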